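/- S spans over ℚ the subspace W_S = {w ∈ W : Ψ(w, ι(v)) = 0 for all v ∈ V₁}, the restriction of Ψ to W_S is non-degenerate, and S is a unimodular lattice in (W_S, Ψ|_{W_S}): the dual lattice of S inside W_S equals S. -/

import Mathlib

open Matrix

noncomputable section

/-- `ψ_M(x, y) = xᵀ M y`, the bilinear form on `ℚᵏ` associated with an integer matrix `M`. -/
def psi {k : ℕ} (M : Matrix (Fin k) (Fin k) ℤ) (x y : Fin k → ℚ) : ℚ :=
  x ⬝ᵥ ((M.map (fun a => (a : ℚ))) *ᵥ y)

/-- A rational number is an integer. -/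
def IsIntQ (q : ℚ) : Prop := ∃ a : ℤ, q = a

/-- A rational vector has integer entries, i.e. belongs to the lattice `ℤᵏ ⊂ ℚᵏ`. -/
def IsIntVec {k : ℕ} (x : Fin k → ℚ) : Prop := ∀ i, IsIntQ (x i)

/-- `x` belongs to the dual lattice of `ℤᵏ` with respect to `ψ_M`. -/
def InDual {k : ℕ} (M : Matrix (Fin k) (Fin k) ℤ) (x : Fin k → ℚ) : Prop :=
  ∀ y, IsIntVec y → IsIntQ (psi M x y)

/-- The form `ψ_R` on `V₁ × V₁`:
`ψ_R((x,y),(x',y')) = ψ_A(x,y') + ψ_A(x',y) + ψ_A(y,y') − ψ_B(f(y),f(y'))`. -/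
def psiR {n m : ℕ} (A : Matrix (Fin n) (Fin n) ℤ) (B : Matrix (Fin m) (Fin m) ℤ)
    (f : (Fin n → ℚ) →ₗ[ℚ] (Fin m → ℚ)) (u v : (Fin n → ℚ) × (Fin n → ℚ)) : ℚ :=
  psi A u.1 v.2 + psi A v.1 u.2 + psi A u.2 v.2 - psi B (f u.2) (f v.2)

/-- Membership in the lattice `R = R₁ × R₁♯ ⊂ V₁ × V₁`. -/
def InR {n : ℕ} (A : Matrix (Fin n) (Fin n) ℤ) (u : (Fin n → ℚ) × (Fin n → ℚ)) : Prop :=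
  IsIntVec u.1 ∧ InDual A u.2

/-- The ambient space `W = (V₁ × V₁) × V₂`. -/
abbrev WSp (n m : ℕ) : Type := ((Fin n → ℚ) × (Fin n → ℚ)) × (Fin m → ℚ)

/-- The orthogonal direct sum form `Ψ = ψ_R ⊕ ψ_B` on `W`. -/
def PsiW {n m : ℕ} (A : Matrix (Fin n) (Fin n) ℤ) (B : Matrix (Fin m) (Fin m) ℤ)
    (f : (Fin n → ℚ) →ₗ[ℚ] (Fin m → ℚ)) (w w' : WSp n m) : ℚ :=
  psiR A B f w.1 w'.1 + psi B w.2 w'.2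

/-- The map `ι : V₁ → W`, `ι(y) = ((0, y), f(y))`. -/
def iota {n m : ℕ} (f : (Fin n → ℚ) →ₗ[ℚ] (Fin m → ℚ)) (y : Fin n → ℚ) : WSp n m :=
  ((0, y), f y)

/-- Membership in `S = {z ∈ R × R₂♯ : Ψ(z, ι(r)) = 0 for all r ∈ R₁♯}`. -/
def InS {n m : ℕ} (A : Matrix (Fin n) (Fin n) ℤ) (B : Matrix (Fin m) (Fin m) ℤ)
    (f : (Fin n → ℚ) →ₗ[ℚ] (Fin m → ℚ)) (w : WSp n m) : Prop :=
  (InR A w.1 ∧ InDual B w.2) ∧ ∀ r, InDual A r → PsiW A B f w (iota f r) = 0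

section helpers

variable {k : ℕ} (M : Matrix (Fin k) (Fin k) ℤ)

theorem psi_add_l (x y z : Fin k → ℚ) : psi M (x + y) z = psi M x z + psi M y z := by
  simp [psi, add_dotProduct]
theorem psi_sub_l (x y z : Fin k → ℚ) : psi M (x - y) z = psi M x z - psi M y z := by
  simp [psi, sub_dotProduct]
theorem psi_neg_l (x z : Fin k → ℚ) : psi M (-x) z = - psi M x z := by
  simp [psi]
theorem psi_smul_l (c : ℚ) (x z : Fin k → ℚ) : psi M (c • x) z = c * psi M x z := by
  simp [psi]
theorem psi_zero_l (z : Fin k → ℚ) : psi M 0 z = 0 := by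
  simp [psi]
theorem psi_add_r (x y z : Fin k → ℚ) : psi M z (x + y) = psi M z x + psi M z y := by
  simp [psi, mulVec_add, dotProduct_add]
theorem psi_sub_r (x y z : Fin k → ℚ) : psi M z (x - y) = psi M z x - psi M z y := by
  simp [psi, mulVec_sub, dotProduct_sub]
theorem psi_neg_r (x z : Fin k → ℚ) : psi M z (-x) = - psi M z x := by
  simp [psi, mulVec_neg]
theorem psi_smul_r (c : ℚ) (x z : Fin k → ℚ) : psi M z (c • x) = c * psi M z x := by
  simp [psi, mulVec_smul]
theorem psi_zero_r (z : Fin k → ℚ) : psi M z 0 = 0 := by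
  simp [psi]

theorem psi_symm (h : M.IsSymm) (x y : Fin k → ℚ) : psi M x y = psi M y x := by
  have h2 : (M.map (fun a => (a : ℚ)))ᵀ = M.map (fun a => (a : ℚ)) := by
    rw [← transpose_map, h.eq]
  unfold psi
  rw [dotProduct_mulVec, ← mulVec_transpose, h2, dotProduct_comm]

theorem isIntQ_add {a b : ℚ} (ha : IsIntQ a) (hb : IsIntQ b) : IsIntQ (a + b) := by
  obtain ⟨p, rfl⟩ := ha
  obtain ⟨q, rfl⟩ := hb
  exact ⟨p + q, by push_cast; rfl⟩
theorem isIntQ_sub {a b : ℚ} (ha : IsIntQ a) (hb : IsIntQ b) : IsIntQ (a - b) := by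
  obtain ⟨p, rfl⟩ := ha
  obtain ⟨q, rfl⟩ := hb
  exact ⟨p - q, by push_cast; rfl⟩
theorem isIntQ_mul {a b : ℚ} (ha : IsIntQ a) (hb : IsIntQ b) : IsIntQ (a * b) := by
  obtain ⟨p, rfl⟩ := ha
  obtain ⟨q, rfl⟩ := hb
  exact ⟨p * q, by push_cast; rfl⟩
theorem isIntQ_zero : IsIntQ 0 := ⟨0, by simp⟩
theorem isIntQ_neg {a : ℚ} (ha : IsIntQ a) : IsIntQ (-a) := by
  simpa using isIntQ_sub isIntQ_zero ha

theorem isIntQ_sum {ι : Type*} (s : Finset ι) (g : ι → ℚ) (h : ∀ i ∈ s, IsIntQ (g i)) :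
    IsIntQ (∑ i ∈ s, g i) :=
  Finset.sum_induction g IsIntQ (fun _ _ => isIntQ_add) isIntQ_zero h

theorem isIntVec_add {x y : Fin k → ℚ} (hx : IsIntVec x) (hy : IsIntVec y) : IsIntVec (x + y) :=
  fun i => isIntQ_add (hx i) (hy i)

theorem int_dual {x : Fin k → ℚ} (hx : IsIntVec x) : InDual M x := by
  intro y hy
  unfold psi dotProduct mulVec dotProduct
  refine isIntQ_sum _ _ fun i _ => isIntQ_mul (hx i) (isIntQ_sum _ _ fun j _ => ?_)
  exact isIntQ_mul ⟨M i j, by simp⟩ (hy j)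

theorem clear_den (x : Fin k → ℚ) : ∃ N : ℤ, N ≠ 0 ∧ IsIntVec ((N : ℚ) • x) := by
  refine ⟨∏ i, ((x i).den : ℤ), Finset.prod_ne_zero_iff.2 fun i _ => by
    exact_mod_cast (x i).den_nz, fun i => ?_⟩
  rw [← Finset.prod_erase_mul _ _ (Finset.mem_univ i)]
  refine ⟨(∏ j ∈ Finset.univ.erase i, ((x j).den : ℤ)) * (x i).num, ?_⟩
  have := Rat.den_mul_eq_num (x i)
  simp only [Pi.smul_apply, smul_eq_mul]
  push_cast
  rw [mul_assoc, this]

theorem isIntVec_smul {x : Fin k → ℚ} (N : ℤ) (hx : IsIntVec x) : IsIntVec ((N : ℚ) • x) :=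
  fun i => isIntQ_mul ⟨N, rfl⟩ (hx i)

/-- Riesz representation. -/
theorem psi_riesz (hs : M.IsSymm) (hd : M.det ≠ 0) (φ : (Fin k → ℚ) →ₗ[ℚ] ℚ) :
    ∃ x, ∀ v, psi M x v = φ v := by
  set Q := M.map (fun a => (a : ℚ)) with hQ
  have hu : IsUnit Q.det := by
    have : Q.det = ((M.det : ℤ) : ℚ) := by
      have := (Int.castRingHom ℚ).map_det M
      simpa using this.symm
    rw [this]
    exact (Int.cast_ne_zero.2 hd).isUnit
  refine ⟨Q⁻¹ *ᵥ (fun i => φ (Pi.single i 1)), fun v => ?_⟩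
  rw [psi_symm M hs]
  unfold psi
  rw [← hQ, mulVec_mulVec, mul_nonsing_inv _ hu, one_mulVec]
  rw [LinearMap.pi_apply_eq_sum_univ φ v]
  simp only [dotProduct, smul_eq_mul]
  refine Finset.sum_congr rfl fun i _ => ?_
  congr 2
  ext j
  simp [Pi.single_apply, eq_comm]

theorem bidual (hs : M.IsSymm) (hd : M.det ≠ 0) (x : Fin k → ℚ)
    (h : ∀ r, InDual M r → IsIntQ (psi M x r)) : IsIntVec x := by
  intro i
  obtain ⟨r, hr⟩ := psi_riesz M hs hd (LinearMap.proj i)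
  have := h r fun y hy => by rw [hr]; exact hy i
  rw [psi_symm M hs, hr] at this
  exact this

theorem psi_nondeg (hs : M.IsSymm) (hd : M.det ≠ 0) (x : Fin k → ℚ)
    (h : ∀ r, psi M x r = 0) : x = 0 := by
  ext i
  obtain ⟨r, hr⟩ := psi_riesz M hs hd (LinearMap.proj i)
  have := h r
  rw [psi_symm M hs, hr] at this
  exact this

variable {n m : ℕ} (A : Matrix (Fin n) (Fin n) ℤ) (B : Matrix (Fin m) (Fin m) ℤ)
    (f : (Fin n → ℚ) →ₗ[ℚ] (Fin m → ℚ))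

theorem PsiW_iota (w : WSp n m) (v : Fin n → ℚ) : PsiW A B f w (iota f v) =
    psi A w.1.1 v + psi A w.1.2 v + psi B (w.2 - f w.1.2) (f v) := by
  simp only [PsiW, psiR, iota, psi_zero_l, psi_sub_l]
  ring

/-- The form on `W_S`. -/
theorem PsiW_WS (hA : A.IsSymm) (hB : B.IsSymm) (w w' : WSp n m)
    (h : ∀ v, PsiW A B f w (iota f v) = 0) (h' : ∀ v, PsiW A B f w' (iota f v) = 0) :
    PsiW A B f w w' = psi B (w.2 - f w.1.2) (w'.2 - f w'.1.2) - psi A w.1.2 w'.1.2 := by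
  have e1 := h w'.1.2
  have e2 := h' w.1.2
  rw [PsiW_iota] at e1 e2
  simp only [PsiW, psiR, psi_sub_l, psi_sub_r] at *
  have s1 := psi_symm A hA w'.1.2 w.1.2
  have s2 := psi_symm B hB w'.2 (f w.1.2)
  have s3 := psi_symm B hB (f w'.1.2) (f w.1.2)
  linarith

theorem WS_exists (hA : A.IsSymm) (hAd : A.det ≠ 0) (u : Fin m → ℚ) (y : Fin n → ℚ) :
    ∃ x, ∀ v, PsiW A B f ((x, y), u + f y) (iota f v) = 0 := by
  let φ : (Fin n → ℚ) →ₗ[ℚ] ℚ :=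
    { toFun := fun v => - psi A y v - psi B u (f v)
      map_add' := fun a b => by rw [map_add, psi_add_r, psi_add_r]; ring
      map_smul' := fun c a => by
        rw [map_smul, psi_smul_r, psi_smul_r]
        simp only [RingHom.id_apply, smul_eq_mul]
        ring }
  obtain ⟨x, hx⟩ := psi_riesz A hA hAd φ
  refine ⟨x, fun v => ?_⟩
  rw [PsiW_iota]
  simp only [add_sub_cancel_right]
  rw [hx v]
  change (- psi A y v - psi B u (f v)) + psi A y v + psi B u (f v) = 0
  ring

theorem InS_WS (w : WSp n m) (h : InS A B f w) (v : Fin n → ℚ) :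
    PsiW A B f w (iota f v) = 0 := by
  obtain ⟨N, hN, hv⟩ := clear_den v
  have := h.2 _ (int_dual A hv)
  rw [PsiW_iota, map_smul, psi_smul_r, psi_smul_r, psi_smul_r, ← mul_add, ← mul_add] at this
  rw [PsiW_iota]
  exact (mul_eq_zero.1 this).resolve_left (by exact_mod_cast hN)

variable (hAsym : A.IsSymm) (hAdet : A.det ≠ 0)
    (hBsym : B.IsSymm) (hBdet : B.det ≠ 0)
    (hfdual : ∀ x, InDual A x → InDual B (f x))
    (hfint : ∀ x, IsIntVec x → IsIntVec (f x))
    (hfsurj : ∀ z, InDual B z → ∃ x, InDual A x ∧ IsIntVec (z - f x))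
    (hfiso : ∀ x y, InDual A x → InDual A y → IsIntQ (psi B (f x) (f y) - psi A x y))

include hBsym hBdet hfsurj in
theorem int_of_pair (z : Fin m → ℚ) (hz : InDual B z)
    (h : ∀ r, InDual A r → IsIntQ (psi B z (f r))) : IsIntVec z := by
  refine bidual B hBsym hBdet z fun r hr => ?_
  obtain ⟨x, hx, hi⟩ := hfsurj r hr
  have := isIntQ_add (hz _ hi) (h x hx)
  rwa [← psi_add_r, sub_add_cancel] at this

include hAsym hAdet hBsym hBdet hfdual hfsurj hfiso in
/-- Description of `S` inside `W_S`. -/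
theorem InS_iff (w : WSp n m) (hw : ∀ v, PsiW A B f w (iota f v) = 0) :
    InS A B f w ↔ InDual A w.1.2 ∧ IsIntVec w.2 := by
  constructor
  · rintro ⟨⟨⟨hx, hy⟩, hz⟩, -⟩
    refine ⟨hy, int_of_pair A B f hBsym hBdet hfsurj _ hz fun r hr => ?_⟩
    have e := hw r
    rw [PsiW_iota, psi_sub_l] at e
    have h1 : IsIntQ (psi A w.1.1 r) := by rw [psi_symm A hAsym]; exact hr _ hx
    have h2 := isIntQ_sub (hfiso _ _ hy hr) h1
    convert h2 using 1
    linarith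
  · rintro ⟨hy, hz⟩
    refine ⟨⟨⟨bidual A hAsym hAdet _ fun r hr => ?_, hy⟩, int_dual B hz⟩, fun r _ => hw r⟩
    have e := hw r
    rw [PsiW_iota, psi_sub_l] at e
    have h1 : IsIntQ (psi B w.2 (f r)) := by
      rw [psi_symm B hBsym]; exact hfdual r hr _ hz
    have h2 := isIntQ_sub (hfiso _ _ hy hr) h1
    convert h2 using 1
    linarith

end helpers

/-- `S` spans `W_S = {w : Ψ(w, ι(v)) = 0 ∀ v ∈ V₁}` over `ℚ`, the
restriction of `Ψ` to `W_S` is non-degenerate, and `S` is a unimodular lattice in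
`(W_S, Ψ|_{W_S})`: the dual lattice of `S` inside `W_S` equals `S`. -/
theorem S_unimodular_in_WS {n m : ℕ}
    (A : Matrix (Fin n) (Fin n) ℤ) (hAsym : A.IsSymm) (hAdet : A.det ≠ 0)
    (B : Matrix (Fin m) (Fin m) ℤ) (hBsym : B.IsSymm) (hBdet : B.det ≠ 0)
    (f : (Fin n → ℚ) →ₗ[ℚ] (Fin m → ℚ))
    (hfdual : ∀ x, InDual A x → InDual B (f x))
    (hfint : ∀ x, IsIntVec x → IsIntVec (f x))
    (hfinj : ∀ x, InDual A x → IsIntVec (f x) → IsIntVec x)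
    (hfsurj : ∀ z, InDual B z → ∃ x, InDual A x ∧ IsIntVec (z - f x))
    (hfiso : ∀ x y, InDual A x → InDual A y → IsIntQ (psi B (f x) (f y) - psi A x y)) :
    ((Submodule.span ℚ {w : WSp n m | InS A B f w} : Set (WSp n m)) =
      {w : WSp n m | ∀ v : Fin n → ℚ, PsiW A B f w (iota f v) = 0}) ∧
    (∀ w : WSp n m, (∀ v : Fin n → ℚ, PsiW A B f w (iota f v) = 0) →
      (∀ w' : WSp n m, (∀ v : Fin n → ℚ, PsiW A B f w' (iota f v) = 0) →
        PsiW A B f w w' = 0) → w = 0) ∧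
    (∀ w : WSp n m,
      ((∀ v : Fin n → ℚ, PsiW A B f w (iota f v) = 0) ∧
        (∀ s, InS A B f s → IsIntQ (PsiW A B f w s))) ↔ InS A B f w) := by
  have key := InS_iff A B f hAsym hAdet hBsym hBdet hfdual hfsurj hfiso
  refine ⟨?_, ?_, ?_⟩
  · ext w
    simp only [SetLike.mem_coe, Set.mem_setOf_eq]
    constructor
    · intro h
      induction h using Submodule.span_induction with
      | mem w h => exact InS_WS A B f w h
      | zero => intro v; simp [PsiW_iota, psi_zero_l]
      | add a b _ _ ha hb =>
        intro v
        have ha := ha v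
        have hb := hb v
        rw [PsiW_iota] at *
        simp only [Prod.fst_add, Prod.snd_add, map_add, psi_add_l, psi_sub_l] at *
        linarith
      | smul c a _ ha =>
        intro v
        have ha := ha v
        rw [PsiW_iota] at *
        simp only [Prod.smul_fst, Prod.smul_snd, map_smul, psi_smul_l, psi_sub_l] at *
        linear_combination c * ha
    · intro h
      obtain ⟨N, hN, hy⟩ := clear_den w.1.2
      obtain ⟨K, hK, hz⟩ := clear_den w.2
      have hc : ((K * N : ℤ) : ℚ) ≠ 0 := by exact_mod_cast mul_ne_zero hK hN
      have hS : InS A B f (((K * N : ℤ) : ℚ) • w) := by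
        refine (key _ fun v => ?_).2 ⟨int_dual A ?_, ?_⟩
        · have ha := h v
          rw [PsiW_iota] at *
          simp only [Prod.smul_fst, Prod.smul_snd, map_smul, psi_smul_l, psi_sub_l] at *
          linear_combination ((K * N : ℤ) : ℚ) * ha
        · have := isIntVec_smul K hy
          rw [smul_smul] at this
          simpa using this
        · have := isIntVec_smul N hz
          rw [smul_smul, mul_comm] at this
          simpa using this
      have := Submodule.smul_mem (Submodule.span ℚ {w : WSp n m | InS A B f w})
        (((K * N : ℤ) : ℚ)⁻¹) (Submodule.subset_span hS)
      rwa [smul_smul, inv_mul_cancel₀ hc, one_smul] at this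
  · intro w hw h
    have hp : ∀ u y, psi B (w.2 - f w.1.2) u - psi A w.1.2 y = 0 := by
      intro u y
      obtain ⟨x, hx⟩ := WS_exists A B f hAsym hAdet u y
      have := h _ hx
      rw [PsiW_WS A B f hAsym hBsym _ _ hw hx] at this
      simpa using this
    have hu : w.2 - f w.1.2 = 0 := psi_nondeg B hBsym hBdet _ fun r => by
      simpa [psi_zero_r] using hp r 0
    have hy : w.1.2 = 0 := psi_nondeg A hAsym hAdet _ fun r => by
      simpa [psi_zero_r] using hp 0 r
    have hz : w.2 = 0 := by simpa [hy] using hu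
    have hx : w.1.1 = 0 := psi_nondeg A hAsym hAdet _ fun r => by
      have := hw r
      rw [PsiW_iota, hu, hy] at this
      simpa [psi_zero_l] using this
    exact Prod.ext (Prod.ext hx hy) hz
  · intro w
    constructor
    · rintro ⟨hw, h⟩
      have hp : ∀ u y, InDual A y → IsIntVec (u + f y) →
          IsIntQ (psi B (w.2 - f w.1.2) u - psi A w.1.2 y) := by
        intro u y hy hu
        obtain ⟨x, hx⟩ := WS_exists A B f hAsym hAdet u y
        have := h _ ((key _ hx).2 ⟨hy, hu⟩)
        rw [PsiW_WS A B f hAsym hBsym _ _ hw hx] at this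
        simpa using this
      have h0 : ∀ {k : ℕ}, IsIntVec (0 : Fin k → ℚ) := fun i => isIntQ_zero
      have hu : InDual B (w.2 - f w.1.2) := fun u hu => by
        simpa [psi_zero_r] using hp u 0 (int_dual A h0) (by simpa using hu)
      have hq : ∀ y, InDual A y → IsIntQ (psi B (w.2 - f w.1.2) (f y) + psi A w.1.2 y) := by
        intro y hy
        have := isIntQ_neg (hp (- f y) y hy (by simpa using h0))
        rw [psi_neg_r] at this
        convert this using 1
        ring
      have hy : InDual A w.1.2 := fun y hy => by
        have := isIntQ_sub (hq y (int_dual A hy)) (hu _ (hfint y hy))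
        simpa using this
      refine (key w hw).2 ⟨hy, int_of_pair A B f hBsym hBdet hfsurj _ ?_ fun r hr => ?_⟩
      · intro v hv
        have := isIntQ_add (hu v hv) (hfdual _ hy v hv)
        rwa [← psi_add_l, sub_add_cancel] at this
      · have := isIntQ_add (hq r hr) (hfiso _ _ hy hr)
        rw [psi_sub_l] at this
        convert this using 1
        ring
    · intro hS
      have hw := InS_WS A B f w hS
      refine ⟨hw, fun s hs => ?_⟩
      have hs' := InS_WS A B f s hs
      rw [PsiW_WS A B f hAsym hBsym _ _ hw hs']
      obtain ⟨hy, hz⟩ := (key w hw).1 hS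
      obtain ⟨hy', hz'⟩ := (key s hs').1 hs
      have h1 := int_dual B hz _ hz'
      have h2 := hfdual _ hy' _ hz
      have h3 := hfdual _ hy _ hz'
      rw [psi_symm B hBsym] at h2
      have := isIntQ_add (isIntQ_sub (isIntQ_sub h1 h2) h3) (hfiso _ _ hy hy')
      simp only [psi_sub_l, psi_sub_r]
      convert this using 1
      ring
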